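/- Let h : ℝ^n → ℝ be measurable, β > 0, ε > 0, α ∈ [0,1], and let x ∈ ℝ^n satisfy h(x) ≥ 0. Suppose w ↦ exp(−β h(F(x,w))) is ρ-integrable and the risk-sensitive safety condition −(1/β) log ∫ exp(−β h(F(x,w))) dρ(w) ≥ α h(x) + ε holds at x. Then ρ({w : h(F(x,w)) ≥ 0}) ≥ 1 − exp(−β(α h(x) + ε)); in particular ρ({w : h(F(x,w)) ≥ 0}) ≥ 1 − exp(−β ε). -/

import Mathlib

open MeasureTheory

/-- Chernoff bound: the probability that `Z` is nonnegative is at least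
`1 - 𝔼[exp (-β Z)]`. -/
theorem one_sub_integral_exp_le_measureReal_nonneg {Ω : Type*} [MeasurableSpace Ω]
    {μ : Measure Ω} [IsProbabilityMeasure μ] {Z : Ω → ℝ} (hZ : Measurable Z) {β : ℝ}
    (hβ : 0 ≤ β) (hint : Integrable (fun ω => Real.exp (-β * Z ω)) μ) :
    1 - ∫ ω, Real.exp (-β * Z ω) ∂μ ≤ μ.real {ω | 0 ≤ Z ω} := by
  have hmarkov := mul_meas_ge_le_integral_of_nonneg
    (Filter.Eventually.of_forall fun ω => (Real.exp_pos (-β * Z ω)).le) hint 1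
  have hsub : {ω | 0 ≤ Z ω}ᶜ ⊆ {ω | 1 ≤ Real.exp (-β * Z ω)} := by
    intro ω hω
    simp only [Set.mem_compl_iff, Set.mem_ofPred_eq, not_le] at hω
    exact Real.one_le_exp (by nlinarith)
  have hmono := measureReal_mono (μ := μ) hsub
  have hcompl := probReal_compl_eq_one_sub (μ := μ) (s := {ω | 0 ≤ Z ω})
    (measurableSet_le measurable_const hZ)
  linarith

/-- An upper bound on the entropic risk gives an upper bound on the exponential moment. -/
theorem le_exp_of_le_neg_inv_mul_log {I β c : ℝ} (hI : 0 < I) (hβ : 0 < β)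
    (hc : c ≤ -(1 / β) * Real.log I) : I ≤ Real.exp (-β * c) := by
  rw [← Real.log_le_iff_le_exp hI]
  have hmul := mul_le_mul_of_nonneg_left hc hβ.le
  have hcancel : β * (-(1 / β) * Real.log I) = -Real.log I := by field_simp
  linarith

/-- If the risk-sensitive safety condition
`-(1/β) log ∫ exp (-β h (F x w)) dρ(w) ≥ α h x + ε` holds at a state `x` with `h x ≥ 0`,
then the next state is safe with probability at least `1 - exp (-β (α h x + ε))`, and in
particular with probability at least `1 - exp (-β ε)`. -/
theorem one_step_risk_sensitive_safety
    {n m : ℕ} (F : (Fin n → ℝ) → (Fin m → ℝ) → (Fin n → ℝ))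
    (hF : Measurable fun p : (Fin n → ℝ) × (Fin m → ℝ) => F p.1 p.2)
    (ρ : Measure (Fin m → ℝ)) [IsProbabilityMeasure ρ]
    (h : (Fin n → ℝ) → ℝ) (hh : Measurable h)
    (β ε α : ℝ) (hβ : 0 < β) (hε : 0 < ε) (hα : α ∈ Set.Icc (0 : ℝ) 1)
    (x : Fin n → ℝ) (hx : 0 ≤ h x)
    (hint : Integrable (fun w => Real.exp (-β * h (F x w))) ρ)
    (hsafe : -(1 / β) * Real.log (∫ w, Real.exp (-β * h (F x w)) ∂ρ) ≥ α * h x + ε) :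
    (ρ {w | 0 ≤ h (F x w)}).toReal ≥ 1 - Real.exp (-β * (α * h x + ε)) ∧
      (ρ {w | 0 ≤ h (F x w)}).toReal ≥ 1 - Real.exp (-β * ε) := by
  have hZ : Measurable fun w => h (F x w) := hh.comp (hF.comp measurable_prodMk_left)
  have hprob := one_sub_integral_exp_le_measureReal_nonneg hZ hβ.le hint
  have hmoment := le_exp_of_le_neg_inv_mul_log (integral_exp_pos hint) hβ hsafe
  have hexp : Real.exp (-β * (α * h x + ε)) ≤ Real.exp (-β * ε) := by
    have := mul_nonneg hβ.le (mul_nonneg hα.1 hx)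
    exact Real.exp_le_exp.2 (by linarith)
  rw [measureReal_def] at hprob
  exact ⟨by linarith, by linarith⟩
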